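/- The function Û is strictly decreasing and strictly convex on the interval (y*, y₀). -/

import Mathlib

open Real Set

noncomputable section

/-- The system (S) of two equations in the unknowns `y` and `η`. -/
def SystemS (κ δ p α y η : ℝ) : Prop :=
  α * Real.log η - Real.log y + α / (η * (1 - p)) - 1 / y = α * (1 + p) - 1 ∧
  α ^ (1 - p * (1 + κ * δ)) * (p * (1 + κ * δ) - 1) *
      (κ * η ^ (1 + κ * δ) / (1 + κ * δ) - η ^ (κ * δ) / (δ * (1 - p))) +
    (κ * y ^ (1 + κ * δ) / (1 + κ * δ) - y ^ (κ * δ) / δ) =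
  (α ^ (1 - p * (1 + κ * δ)) - 1) / (δ * (1 + κ * δ))

def C1 (κ δ p α η : ℝ) : ℝ :=
  -(κ * α / (1 + κ * δ)) *
    (Real.log η - p * Real.log α + 1 / (η * (1 - p)) + 1 / (1 + κ * δ))

def C2 (κ δ p α η : ℝ) : ℝ :=
  α ^ (1 - p * (1 + κ * δ)) / (1 + κ * δ) *
    (κ * η ^ (1 + κ * δ) / (1 + κ * δ) - η ^ (κ * δ) / (δ * (1 - p)))

def C3 (κ δ p α η : ℝ) : ℝ :=
  -(κ * α / (1 + κ * δ)) * (Real.log η + 1 / (η * (1 - p)) - (1 + p))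

def C4 (κ δ p α η : ℝ) : ℝ :=
  α ^ (1 - p * (1 + κ * δ)) / (1 + κ * δ) *
    (κ * η ^ (1 + κ * δ) / (1 + κ * δ) - η ^ (κ * δ) / (δ * (1 - p)) -
      1 / (δ * (1 + κ * δ) * (p * (1 + κ * δ) - 1)))

def C5 (κ δ p α η : ℝ) : ℝ :=
  -(κ / (1 + κ * δ)) *
    (α * Real.log η + α / (η * (1 - p)) + (1 - α) * (1 + p) + 1 / (1 + κ * δ))

def C6 (κ δ p α η : ℝ) : ℝ :=
  C2 κ δ p α η -
    (α ^ (1 - p * (1 + κ * δ)) - 1) / (δ * (1 + κ * δ) ^ 2 * (p * (1 + κ * δ) - 1))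

/-- The dual function `Û`, defined piecewise (here `η` stands for `η*`). -/
def Uhat (κ δ p α η : ℝ) (y : ℝ) : ℝ :=
  if α ^ (-p) ≤ y then
    C1 κ δ p α η * y + C2 κ δ p α η * y ^ (-(κ * δ)) +
      κ * α / (1 + κ * δ) * (y * Real.log y) + α ^ (1 - p) / (δ * (1 - p))
  else if 1 < y then
    C3 κ δ p α η * y + C4 κ δ p α η * y ^ (-(κ * δ)) +
      κ * p ^ 3 / ((1 - p) * (p * (1 + κ * δ) - 1)) * y ^ (-(1 - p) / p)
  else
    C5 κ δ p α η * y + C6 κ δ p α η * y ^ (-(κ * δ)) +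
      κ / (1 + κ * δ) * (y * Real.log y) + 1 / (δ * (1 - p))


theorem hasDerivAt_ite_le {c y : ℝ} {f g f' g' : ℝ → ℝ}
    (hf : c ≤ y → HasDerivAt f (f' y) y) (hg : y ≤ c → HasDerivAt g (g' y) y)
    (hc : f c = g c) (hc' : f' c = g' c) :
    HasDerivAt (fun x => if c ≤ x then f x else g x) (if c ≤ y then f' y else g' y) y := by
  rcases lt_trichotomy c y with h | rfl | h
  · rw [if_pos h.le]
    refine (hf h.le).congr_of_eventuallyEq ?_
    filter_upwards [lt_mem_nhds h] with x hx
    rw [if_pos (le_of_lt hx)]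
  · rw [if_pos le_rfl, ← hasDerivWithinAt_univ, ← Iic_union_Ici (a := c)]
    refine HasDerivWithinAt.union ?_ ?_
    · have h := (hg le_rfl).hasDerivWithinAt (s := Iic c)
      rw [← hc'] at h
      refine h.congr (fun x hx => ?_) (by simp [hc])
      rcases eq_or_lt_of_le (show x ≤ c from hx) with rfl | hlt
      · simp [hc]
      · simp [not_le.2 hlt]
    · refine (hf le_rfl).hasDerivWithinAt.congr (fun x hx => ?_) (by simp)
      rw [if_pos (show c ≤ x from hx)]
  · rw [if_neg (not_le.2 h)]
    refine (hg h.le).congr_of_eventuallyEq ?_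
    filter_upwards [gt_mem_nhds h] with x hx
    rw [if_neg (not_le.2 hx)]

theorem strictMonoOn_ite_le {c l u : ℝ} {f g : ℝ → ℝ}
    (hlc : l ≤ c) (hcu : c ≤ u)
    (hf : StrictMonoOn f (Icc c u)) (hg : StrictMonoOn g (Icc l c)) (hc : f c = g c) :
    StrictMonoOn (fun x => if c ≤ x then f x else g x) (Icc l u) := by
  rw [← Icc_union_Icc_eq_Icc hlc hcu]
  refine StrictMonoOn.union (c := c) ?_ ?_ (isGreatest_Icc hlc) (isLeast_Icc hcu)
  · refine hg.congr fun x hx => ?_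
    rcases eq_or_lt_of_le hx.2 with rfl | hlt
    · simp [hc]
    · simp [not_le.2 hlt]
  · exact hf.congr fun x hx => by simp [hx.1]

theorem strictMonoOn_Icc_of_hasDerivAt_pos {l u : ℝ} {f f' : ℝ → ℝ}
    (hf : ∀ x ∈ Icc l u, HasDerivAt f (f' x) x) (hpos : ∀ x ∈ Icc l u, 0 < f' x) :
    StrictMonoOn f (Icc l u) :=
  strictMonoOn_of_hasDerivWithinAt_pos (convex_Icc l u)
    (fun x hx => (hf x hx).continuousAt.continuousWithinAt)
    (fun x hx => (hf x (interior_subset hx)).hasDerivWithinAt)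
    (fun x hx => hpos x (interior_subset hx))

theorem strictAntiOn_and_strictConvexOn_of_strictMonoOn_deriv {l u : ℝ} {f f' : ℝ → ℝ}
    (hlu : l ≤ u) (hf : ∀ x ∈ Ioo l u, HasDerivAt f (f' x) x)
    (hmono : StrictMonoOn f' (Icc l u)) (hu : f' u = 0) :
    StrictAntiOn f (Ioo l u) ∧ StrictConvexOn ℝ (Ioo l u) f := by
  have hcont : ContinuousOn f (Ioo l u) :=
    fun x hx => (hf x hx).continuousAt.continuousWithinAt
  refine ⟨strictAntiOn_of_deriv_neg (convex_Ioo l u) hcont fun x hx => ?_,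
    StrictMonoOn.strictConvexOn_of_deriv (convex_Ioo l u) hcont ?_⟩
  · rw [interior_Ioo] at hx
    rw [(hf x hx).deriv, ← hu]
    exact hmono (Ioo_subset_Icc_self hx) (right_mem_Icc.2 hlu) hx.2
  · rw [interior_Ioo]
    exact (hmono.mono Ioo_subset_Icc_self).congr fun x hx => (hf x hx).deriv.symm

theorem hasDerivAt_linear_add_rpow_add_mul_log (b c d k e : ℝ) {y : ℝ} (hy : 0 < y) :
    HasDerivAt (fun x => c * x + d * x ^ (-b) + k * (x * Real.log x) + e)
      (c - b * d * y ^ (-b - 1) + k * (Real.log y + 1)) y := by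
  have h := ((((hasDerivAt_id y).const_mul c).add
    ((Real.hasDerivAt_rpow_const (p := -b) (Or.inl hy.ne')).const_mul d)).add
    ((Real.hasDerivAt_mul_log hy.ne').const_mul k)).add_const e
  refine h.congr_deriv ?_
  ring

theorem hasDerivAt_const_sub_rpow_add_log (b c d k : ℝ) {y : ℝ} (hy : 0 < y) :
    HasDerivAt (fun x => c - b * d * x ^ (-b - 1) + k * (Real.log x + 1))
      (y ^ (-b - 2) * (b * (1 + b) * d + k * y ^ (1 + b))) y := by
  have h := (((Real.hasDerivAt_rpow_const (p := -b - 1) (Or.inl hy.ne')).const_mul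
    (b * d)).const_sub c).add (((Real.hasDerivAt_log hy.ne').add_const 1).const_mul k)
  refine h.congr_deriv ?_
  have e1 : y ^ (-b - 2) * y ^ (1 + b) = y⁻¹ := by
    rw [← Real.rpow_add hy, ← Real.rpow_neg_one]; congr 1; ring
  rw [show -b - 1 - 1 = -b - 2 by ring, ← e1]
  ring

theorem hasDerivAt_linear_add_rpow_add_rpow (b c d m r : ℝ) {y : ℝ} (hy : 0 < y) :
    HasDerivAt (fun x => c * x + d * x ^ (-b) + m * x ^ r)
      (c - b * d * y ^ (-b - 1) + r * m * y ^ (r - 1)) y := by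
  have h := (((hasDerivAt_id y).const_mul c).add
    ((Real.hasDerivAt_rpow_const (p := -b) (Or.inl hy.ne')).const_mul d)).add
    ((Real.hasDerivAt_rpow_const (p := r) (Or.inl hy.ne')).const_mul m)
  refine h.congr_deriv ?_
  ring

theorem hasDerivAt_const_sub_rpow_add_rpow (b c d m r : ℝ) {y : ℝ} (hy : 0 < y) :
    HasDerivAt (fun x => c - b * d * x ^ (-b - 1) + r * m * x ^ (r - 1))
      (y ^ (-b - 2) * (b * (1 + b) * d + r * (r - 1) * m * y ^ (r + b))) y := by
  have h := (((Real.hasDerivAt_rpow_const (p := -b - 1) (Or.inl hy.ne')).const_mul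
    (b * d)).const_sub c).add
    ((Real.hasDerivAt_rpow_const (p := r - 1) (Or.inl hy.ne')).const_mul (r * m))
  refine h.congr_deriv ?_
  have e1 : y ^ (-b - 2) * y ^ (r + b) = y ^ (r - 1 - 1) := by
    rw [← Real.rpow_add hy]; congr 1; ring
  rw [show -b - 1 - 1 = -b - 2 by ring, ← e1]
  ring

set_option maxHeartbeats 800000 in
theorem stmt3 (μ σ δ p α κ : ℝ)
    (hμ : 0 < μ) (hσ : 0 < σ) (hδ : 0 < δ) (hκ : κ = 2 * σ ^ 2 / μ ^ 2)
    (hα : α ∈ Set.Ioo (0 : ℝ) 1) (hp1 : 1 / (1 + κ * δ) < p) (hp2 : p < 1) (ystar ηstar y0 : ℝ)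
    (hy : ystar ∈ Set.Ioo (0 : ℝ) 1) (hη : 1 < ηstar)
    (hS : SystemS κ δ p α ystar ηstar) (hy0 : y0 = ηstar * α ^ (-p)) :
    StrictAntiOn (Uhat κ δ p α ηstar) (Set.Ioo ystar y0) ∧
      StrictConvexOn ℝ (Set.Ioo ystar y0) (Uhat κ δ p α ηstar) := by
  obtain ⟨hα0, hα1⟩ := hα
  obtain ⟨hy1, hy2⟩ := hy
  obtain ⟨-, hE⟩ := hS
  have hκ0 : 0 < κ := by rw [hκ]; positivity
  clear hκ
  obtain ⟨b, hb⟩ : ∃ b, b = κ * δ := ⟨_, rfl⟩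
  have hb0 : 0 < b := by rw [hb]; positivity
  have hκb : κ = b / δ := by rw [hb]; field_simp
  obtain ⟨q, hq⟩ : ∃ q, q = p * (1 + b) - 1 := ⟨_, rfl⟩
  have hq0 : 0 < q := by
    rw [← hb, div_lt_iff₀ (by positivity)] at hp1
    rw [hq]; linarith
  have hp0 : 0 < p := lt_trans (by positivity) hp1
  have hp1' : 0 < 1 - p := by linarith
  have hη0 : 0 < ηstar := by linarith
  obtain ⟨a, ha⟩ : ∃ a, a = α ^ (-p) := ⟨_, rfl⟩
  have ha1 : 1 < a := by
    rw [ha]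
    exact Real.one_lt_rpow_of_pos_of_lt_one_of_neg hα0 hα1 (by linarith)
  have ha0 : 0 < a := by linarith
  have hay0 : a < y0 := by rw [hy0, ← ha]; exact lt_mul_of_one_lt_left ha0 hη
  have hloga : Real.log a = -p * Real.log α := by rw [ha, Real.log_rpow hα0]
  obtain ⟨A, hA⟩ : ∃ A, A = α ^ (-q) := ⟨_, rfl⟩
  have hA' : α ^ (1 - p * (1 + κ * δ)) = A := by rw [hA, ← hb, hq]; congr 1; ring
  obtain ⟨r, hr⟩ : ∃ r, r = -(1 - p) / p := ⟨_, rfl⟩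
  have hrp : r * p = p - 1 := by rw [hr]; field_simp; ring
  have hapow : ∀ s, a ^ s = α ^ (-p * s) := fun s => by rw [ha, ← Real.rpow_mul hα0.le]
  have haneg : a ^ (-b - 1) * A = α := by
    rw [hapow, hA, ← Real.rpow_add hα0]
    conv_rhs => rw [← Real.rpow_one α]
    congr 1; rw [hq]; ring
  have haneg' : a ^ (-b) * A = α ^ (1 - p) := by
    rw [hapow, hA, ← Real.rpow_add hα0]
    congr 1; rw [hq]; ring
  have har : a ^ r = α ^ (1 - p) := by
    rw [hapow]; congr 1; linear_combination -hrp
  have har' : a ^ (r - 1) = α := by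
    rw [hapow]
    conv_rhs => rw [← Real.rpow_one α]
    congr 1; linear_combination -hrp
  have haA : a * α = α ^ (1 - p) := by
    rw [ha]
    conv_lhs => rw [← Real.rpow_one α, ← Real.rpow_mul hα0.le, ← Real.rpow_add hα0]
    congr 1; ring
  have hapos : α * a ^ (1 + b) = A := by
    rw [hapow, hA]
    conv_lhs => rw [← Real.rpow_one α, ← Real.rpow_mul hα0.le, ← Real.rpow_add hα0]
    congr 1; rw [hq]; ring
  have hamid : a ^ (r + b) = A := by
    rw [hapow, hA]
    congr 1; rw [hq]; linear_combination -hrp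
  have hηpow : ηstar ^ (-b - 1) * ηstar ^ (1 + b) = 1 := by
    rw [← Real.rpow_add hη0, show -b - 1 + (1 + b) = 0 by ring, Real.rpow_zero]
  have hηpow' : ηstar ^ (-b - 1) * ηstar ^ b = 1 / ηstar := by
    rw [← Real.rpow_add hη0, show -b - 1 + b = -1 by ring, Real.rpow_neg_one, one_div]
  have hy0pow : y0 ^ (-b - 1) = ηstar ^ (-b - 1) * a ^ (-b - 1) := by
    rw [hy0, ← ha, Real.mul_rpow hη0.le ha0.le]
  have hy0log : Real.log y0 = Real.log ηstar - p * Real.log α := by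
    rw [hy0, ← ha, Real.log_mul hη0.ne' ha0.ne', hloga]; ring
  have hp_eq : p = (q + 1) / (1 + b) := by rw [hq]; field_simp; ring
  have h4 : C4 κ δ p α ηstar = C2 κ δ p α ηstar - A / (δ * (1 + b) ^ 2 * q) := by
    unfold C4 C2
    rw [hA', ← hb, ← hq]
    field_simp
  have h6 : C6 κ δ p α ηstar = C2 κ δ p α ηstar - (A - 1) / (δ * (1 + b) ^ 2 * q) := by
    unfold C6
    rw [hA', ← hb, ← hq]
  have h6pos : 0 < C6 κ δ p α ηstar := by
    have hyb : ystar ^ (1 + b) = ystar * ystar ^ b := by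
      rw [Real.rpow_add hy1, Real.rpow_one]
    have hyb0 : 0 < ystar ^ b := Real.rpow_pos_of_pos hy1 b
    have key : q * (1 + b) * C6 κ δ p α ηstar
        = ystar ^ b / (δ * (1 + b)) * (1 + b - b * ystar) := by
      rw [h6]
      unfold C2
      rw [hA', ← hb, ← hq, hyb] at hE
      rw [hA', ← hb]
      have e1 : q * (1 + b) * ((A - 1) / (δ * (1 + b) ^ 2 * q)) = (A - 1) / (δ * (1 + b)) := by
        field_simp
      rw [mul_sub, e1, ← hE, hκb]
      field_simp
      ring
    have : 0 < q * (1 + b) * C6 κ δ p α ηstar := by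
      rw [key]
      have : 0 < 1 + b - b * ystar := by linarith [mul_pos hb0 (sub_pos.2 hy2)]
      positivity
    exact pos_of_mul_pos_right this (by positivity)
  set m := κ * p ^ 3 / ((1 - p) * q) with hm
  have hrm : r * m = -(κ * p ^ 2 / q) := by
    rw [hm, hr]; field_simp
  have hrm' : r * (r - 1) * m = κ * p / q := by
    rw [hm, hr]; field_simp; ring
  have hmid : b * (1 + b) * C4 κ δ p α ηstar + κ * p / q
      = b * (1 + b) * C6 κ δ p α ηstar + κ / (1 + b) := by
    rw [h4, h6, hκb, hp_eq]
    field_simp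
    ring
  have h13 : C1 κ δ p α ηstar - C3 κ δ p α ηstar
      = κ * α / (1 + b) * (p * Real.log α - 1 / (1 + b) - (1 + p)) := by
    unfold C1 C3
    rw [← hb]
    ring
  have h35 : C3 κ δ p α ηstar - C5 κ δ p α ηstar = κ / (1 + b) * (1 + p + 1 / (1 + b)) := by
    unfold C3 C5
    rw [← hb]
    ring
  have h24 : b * C2 κ δ p α ηstar - b * C4 κ δ p α ηstar = κ * A / ((1 + b) ^ 2 * q) := by
    rw [h4, hκb]
    field_simp
    ring
  have h46 : b * C4 κ δ p α ηstar - b * C6 κ δ p α ηstar = -(κ / ((1 + b) ^ 2 * q)) := by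
    rw [h4, h6, hκb]
    field_simp
    ring
  have hm1 : m = 1 / (δ * (1 - p)) - κ / (1 + b) * (1 + p + 1 / (1 + b))
      + 1 / (δ * (1 + b) ^ 2 * q) := by
    rw [hm, hκb]
    field_simp
    rw [hq]
    ring
  have hpq : p ^ 2 / q = 1 / (1 + b) / (1 + b) + p / (1 + b) + 1 / ((1 + b) ^ 2 * q) := by
    field_simp
    rw [hq]
    ring
  have hval_one : C3 κ δ p α ηstar * 1 + C4 κ δ p α ηstar * 1 ^ (-b) + m * 1 ^ r
      = C5 κ δ p α ηstar * 1 + C6 κ δ p α ηstar * 1 ^ (-b) +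
        κ / (1 + b) * (1 * Real.log 1) + 1 / (δ * (1 - p)) := by
    simp only [Real.one_rpow, Real.log_one]
    rw [h4, h6]
    linear_combination h35 + hm1
  have hUhat : Uhat κ δ p α ηstar = fun x => if a ≤ x then
      C1 κ δ p α ηstar * x + C2 κ δ p α ηstar * x ^ (-b) +
        κ * α / (1 + b) * (x * Real.log x) + α ^ (1 - p) / (δ * (1 - p))
    else if 1 ≤ x then
      C3 κ δ p α ηstar * x + C4 κ δ p α ηstar * x ^ (-b) + m * x ^ r
    else
      C5 κ δ p α ηstar * x + C6 κ δ p α ηstar * x ^ (-b) +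
        κ / (1 + b) * (x * Real.log x) + 1 / (δ * (1 - p)) := by
    funext x
    unfold Uhat
    rw [← ha, ← hb, ← hq, ← hr, ← hm]
    split_ifs with h1 h2 h3 h3
    · rfl
    · rfl
    · linarith
    · obtain rfl : x = 1 := by linarith
      exact hval_one.symm
    · rfl
  have hder_one : C3 κ δ p α ηstar - b * C4 κ δ p α ηstar * 1 ^ (-b - 1) + r * m * 1 ^ (r - 1)
      = C5 κ δ p α ηstar - b * C6 κ δ p α ηstar * 1 ^ (-b - 1) +
        κ / (1 + b) * (Real.log 1 + 1) := by
    simp only [Real.one_rpow, Real.log_one]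
    linear_combination h35 - h46 + hrm - κ * hpq
  have hval_a : C1 κ δ p α ηstar * a + C2 κ δ p α ηstar * a ^ (-b) +
        κ * α / (1 + b) * (a * Real.log a) + α ^ (1 - p) / (δ * (1 - p))
      = C3 κ δ p α ηstar * a + C4 κ δ p α ηstar * a ^ (-b) + m * a ^ r := by
    rw [h4, har, hloga]
    linear_combination a * h13 + 1 / (δ * (1 + b) ^ 2 * q) * haneg' +
      κ / (1 + b) * (-(1 / (1 + b)) - (1 + p)) * haA - α ^ (1 - p) * hm1
  have hder_a : C1 κ δ p α ηstar - b * C2 κ δ p α ηstar * a ^ (-b - 1) +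
        κ * α / (1 + b) * (Real.log a + 1)
      = C3 κ δ p α ηstar - b * C4 κ δ p α ηstar * a ^ (-b - 1) + r * m * a ^ (r - 1) := by
    rw [har', hloga]
    linear_combination h13 - a ^ (-b - 1) * h24 - κ / ((1 + b) ^ 2 * q) * haneg -
      α * hrm + κ * α * hpq
  have hder_y0 : C1 κ δ p α ηstar - b * C2 κ δ p α ηstar * y0 ^ (-b - 1) +
        κ * α / (1 + b) * (Real.log y0 + 1) = 0 := by
    have e1 : b * C2 κ δ p α ηstar * y0 ^ (-b - 1)
        = b / (1 + b) * α * (κ / (1 + b) - 1 / ηstar / (δ * (1 - p))) := by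
      rw [hy0pow]
      unfold C2
      rw [hA', ← hb]
      linear_combination b / (1 + b) * (κ / (1 + b) * (ηstar ^ (-b - 1) * ηstar ^ (1 + b)) -
          (ηstar ^ (-b - 1) * ηstar ^ b) / (δ * (1 - p))) * haneg +
        b / (1 + b) * α * κ / (1 + b) * hηpow - b / (1 + b) * α / (δ * (1 - p)) * hηpow'
    rw [e1, hy0log]
    unfold C1
    rw [← hb, hκb]
    field_simp
    ring
  have hpos_mid : ∀ x, 1 ≤ x →
      0 < b * (1 + b) * C4 κ δ p α ηstar + κ * p / q * x ^ (r + b) := fun x hx => by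
    have : 1 ≤ x ^ (r + b) := by
      refine Real.one_le_rpow hx (le_of_lt (pos_of_mul_pos_left (b := p) ?_ hp0.le))
      linarith
    have h1 : κ * p / q * 1 ≤ κ * p / q * x ^ (r + b) := by gcongr
    have h2 : 0 < b * (1 + b) * C6 κ δ p α ηstar + κ / (1 + b) := by positivity
    linarith
  have hpos_right : ∀ x, a ≤ x →
      0 < b * (1 + b) * C2 κ δ p α ηstar + κ * α / (1 + b) * x ^ (1 + b) := fun x hx => by
    have h1 : κ * α / (1 + b) * a ^ (1 + b) ≤ κ * α / (1 + b) * x ^ (1 + b) := by gcongr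
    have h2 := hpos_mid a ha1.le
    have h3 : κ * α / (1 + b) * a ^ (1 + b) = κ / (1 + b) * A := by rw [← hapos]; ring
    have h4' : b * (1 + b) * C4 κ δ p α ηstar + κ * p / q * A
        = b * (1 + b) * C2 κ δ p α ηstar + κ / (1 + b) * A := by
      rw [h4, hκb, hp_eq]
      field_simp
      ring
    rw [hamid] at h2
    linarith
  rw [hUhat]
  refine strictAntiOn_and_strictConvexOn_of_strictMonoOn_deriv (by linarith)
    (fun x hx => hasDerivAt_ite_le
      (fun h => hasDerivAt_linear_add_rpow_add_mul_log _ _ _ _ _ (by linarith))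
      (fun h => hasDerivAt_ite_le
        (fun h => hasDerivAt_linear_add_rpow_add_rpow _ _ _ _ _ (by linarith))
        (fun h => hasDerivAt_linear_add_rpow_add_mul_log _ _ _ _ _ (by linarith [hx.1]))
        hval_one hder_one)
      (by rw [if_pos ha1.le]; exact hval_a) (by rw [if_pos ha1.le]; exact hder_a))
    (strictMonoOn_ite_le (by linarith) hay0.le ?_
      (strictMonoOn_ite_le hy2.le ha1.le ?_ ?_ hder_one)
      (by rw [if_pos ha1.le]; exact hder_a))
    (by rw [if_pos hay0.le]; exact hder_y0)
  · refine strictMonoOn_Icc_of_hasDerivAt_pos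
      (fun x hx => hasDerivAt_const_sub_rpow_add_log _ _ _ _ (by linarith [hx.1])) fun x hx => ?_
    exact mul_pos (Real.rpow_pos_of_pos (by linarith [hx.1]) _) (hpos_right x hx.1)
  · refine strictMonoOn_Icc_of_hasDerivAt_pos
      (fun x hx => hasDerivAt_const_sub_rpow_add_rpow _ _ _ _ _ (by linarith [hx.1]))
      fun x hx => ?_
    rw [hrm']
    exact mul_pos (Real.rpow_pos_of_pos (by linarith [hx.1]) _) (hpos_mid x hx.1)
  · refine strictMonoOn_Icc_of_hasDerivAt_pos
      (fun x hx => hasDerivAt_const_sub_rpow_add_log _ _ _ _ (by linarith [hx.1])) fun x hx => ?_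
    have hx0 : 0 < x := by linarith [hx.1]
    positivity

end
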